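/- arXiv:2304.09039 — 2 statements merged into one kernel-verified Lean document; each statement's English description precedes it below -/
import Mathlib

section
/- Let B=(1,b_2,...,b_k) with 1<b_2<...<b_k positive integers (k≥2), let c = max{O_B(r) : 0 ≤ r ≤ b_k−1} with c ≥ 2, and set u = max{c−1, ⌈(c−1)b_{k−1}/(b_k−b_{k−1})⌉}. Let a,h,d be positive integers with gcd(a,d)=1. If a ≥ (u+c−1)b_k, then max{N_{dr} : 0 ≤ r ≤ a−1} = max{N_{dr} : a−b_k ≤ r ≤ a−1}. -/
/-- `OB k b M` is the minimum of `x 1 + ⋯ + x k` over all nonnegative integer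
solutions of `x 1 * b 1 + ⋯ + x k * b k = M`. -/
noncomputable def OB (k : ℕ) (b : ℕ → ℕ) (M : ℕ) : ℕ :=
  sInf {n : ℕ | ∃ x : ℕ → ℕ,
    (∑ i ∈ Finset.Icc 1 k, x i * b i) = M ∧ (∑ i ∈ Finset.Icc 1 k, x i) = n}


/-- `Ndr k b a h d r` is the least element of the numerical semigroup generated by
`(a, h*a + d*b 1, …, h*a + d*b k)` that is congruent to `d*r` modulo `a`. -/
noncomputable def Ndr (k : ℕ) (b : ℕ → ℕ) (a h d r : ℕ) : ℕ :=
  sInf {n : ℕ | (∃ x0 : ℕ, ∃ x : ℕ → ℕ,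
      n = x0 * a + ∑ i ∈ Finset.Icc 1 k, x i * (h * a + d * b i)) ∧ n % a = d * r % a}

open Finset

/-- An increasing sequence on `{1, …, k}` is monotone there. -/
lemma le_of_step_lt {k : ℕ} {b : ℕ → ℕ} (hmono : ∀ i, 1 ≤ i → i < k → b i < b (i + 1))
    {i j : ℕ} (hi : 1 ≤ i) (hij : i ≤ j) (hj : j ≤ k) : b i ≤ b j := by
  induction j, hij using Nat.le_induction with
  | base => exact le_rfl
  | succ j hij ih => exact (ih (by omega)).trans (hmono j (by omega) (by omega)).le

lemma OB_le (k : ℕ) (b x : ℕ → ℕ) :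
    OB k b (∑ i ∈ Icc 1 k, x i * b i) ≤ ∑ i ∈ Icc 1 k, x i :=
  Nat.sInf_le ⟨x, rfl, rfl⟩

lemma exists_OB_eq {k : ℕ} {b : ℕ → ℕ} (hk : 1 ≤ k) (hb1 : b 1 = 1) (M : ℕ) :
    ∃ x : ℕ → ℕ, ∑ i ∈ Icc 1 k, x i * b i = M ∧ ∑ i ∈ Icc 1 k, x i = OB k b M := by
  refine Nat.sInf_mem (s := {n : ℕ | ∃ x : ℕ → ℕ,
    (∑ i ∈ Icc 1 k, x i * b i) = M ∧ (∑ i ∈ Icc 1 k, x i) = n}) ?_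
  refine ⟨_, fun i => if i = 1 then M else 0, ?_, rfl⟩
  simp [ite_mul, hk, hb1]

lemma OB_add_last_le {k : ℕ} {b : ℕ → ℕ} (hk : 1 ≤ k) (hb1 : b 1 = 1) (M : ℕ) :
    OB k b (M + b k) ≤ OB k b M + 1 := by
  obtain ⟨x, hx, hs⟩ := exists_OB_eq hk hb1 M
  have key := OB_le k b (fun i => x i + if i = k then 1 else 0)
  simpa [add_mul, sum_add_distrib, ite_mul, hk, hx, hs] using key

lemma OB_mul_last_add_le {k : ℕ} {b : ℕ → ℕ} (hk : 1 ≤ k) (hb1 : b 1 = 1) (q s : ℕ) :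
    OB k b (q * b k + s) ≤ q + OB k b s := by
  induction q with
  | zero => simp
  | succ q ih =>
    have := OB_add_last_le hk hb1 (q * b k + s)
    rw [show (q + 1) * b k + s = q * b k + s + b k by ring]
    omega

/-- Removing one copy of the largest part does not increase `OB`,
once the optimal representation uses that part. -/
lemma OB_le_of_last_pos {k : ℕ} {b x : ℕ → ℕ} (hk : 1 ≤ k) {M : ℕ}
    (hx : ∑ i ∈ Icc 1 k, x i * b i = M + b k) (hpos : 0 < x k) :
    OB k b M ≤ ∑ i ∈ Icc 1 k, x i := by
  have hxk : ∀ i, x i = (x i - if i = k then 1 else 0) + if i = k then 1 else 0 := by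
    intro i
    split_ifs with h
    · subst h; omega
    · omega
  have hsum : ∑ i ∈ Icc 1 k, (x i - if i = k then 1 else 0) * b i = M := by
    rw [sum_congr rfl fun i _ => congrArg (· * b i) (hxk i)] at hx
    simpa [add_mul, sum_add_distrib, ite_mul, hk] using hx
  have key := OB_le k b (fun i => x i - if i = k then 1 else 0)
  rw [hsum] at key
  exact key.trans (sum_le_sum fun i _ => Nat.sub_le _ _)

lemma le_OB_mul_last {k : ℕ} {b : ℕ → ℕ} (hk : 1 ≤ k) (hb1 : b 1 = 1)
    (hmono : ∀ i, 1 ≤ i → i < k → b i < b (i + 1)) (M : ℕ) : M ≤ OB k b M * b k := by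
  obtain ⟨x, hx, hs⟩ := exists_OB_eq hk hb1 M
  rw [← hs, sum_mul, ← hx]
  refine sum_le_sum fun i hi => Nat.mul_le_mul_left _ ?_
  rw [mem_Icc] at hi
  exact le_of_step_lt hmono hi.1 hi.2 le_rfl

/-- A representation not using the largest part needs at least `M / b (k - 1)` parts. -/
lemma sum_le_of_last_eq_zero {k : ℕ} {b x : ℕ → ℕ}
    (hmono : ∀ i, 1 ≤ i → i < k → b i < b (i + 1)) (h0 : x k = 0) :
    ∑ i ∈ Icc 1 k, x i * b i ≤ (∑ i ∈ Icc 1 k, x i) * b (k - 1) := by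
  rw [sum_mul]
  refine sum_le_sum fun i hi => ?_
  rw [mem_Icc] at hi
  rcases eq_or_ne i k with rfl | hne
  · simp [h0]
  · exact Nat.mul_le_mul_left _ (le_of_step_lt hmono hi.1 (by omega) (by omega))

lemma OB_le_div_add {k : ℕ} {b : ℕ → ℕ} (hk : 1 ≤ k) (hb1 : b 1 = 1) (hbk : 0 < b k)
    (M : ℕ) : OB k b M ≤ M / b k + (range (b k)).sup fun r => OB k b r := by
  have h1 := OB_mul_last_add_le hk hb1 (M / b k) (M % b k)
  have h2 : OB k b (M % b k) ≤ (range (b k)).sup fun r => OB k b r :=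
    le_sup (f := fun r => OB k b r) (mem_range.2 (Nat.mod_lt _ hbk))
  rw [mul_comm, Nat.div_add_mod] at h1
  omega

lemma OB_le_OB_add_last {k : ℕ} {b : ℕ → ℕ} (hk : 2 ≤ k) (hb1 : b 1 = 1)
    (hmono : ∀ i, 1 ≤ i → i < k → b i < b (i + 1)) {c u : ℕ}
    (hc : c = (range (b k)).sup fun r => OB k b r) (hc1 : 1 ≤ c)
    (hu : (c - 1) * b (k - 1) ≤ (b k - b (k - 1)) * u) {M : ℕ} (hM : (u - 1) * b k ≤ M) :
    OB k b M ≤ OB k b (M + b k) := by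
  have hk1 : 1 ≤ k := by omega
  have hlt : b (k - 1) < b k := by
    simpa [Nat.sub_add_cancel hk1] using hmono (k - 1) (by omega) (by omega)
  have hpos : 0 < b (k - 1) := by
    have := le_of_step_lt hmono le_rfl (show 1 ≤ k - 1 by omega) (by omega)
    omega
  obtain ⟨x, hx, hs⟩ := exists_OB_eq hk1 hb1 (M + b k)
  rcases Nat.eq_zero_or_pos (x k) with h0 | h0
  · have h1 := sum_le_of_last_eq_zero hmono h0
    have h2 := OB_le_div_add hk1 hb1 (by omega) M
    rw [← hc] at h2
    rw [hx, hs] at h1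
    refine h2.trans (Nat.le_of_mul_le_mul_right (h1.trans' ?_) hpos)
    have hq : u ≤ M / b k + 1 := by
      have := (Nat.le_div_iff_mul_le (by omega)).2 hM
      omega
    have hqM : M / b k * b k ≤ M := Nat.div_mul_le_self _ _
    obtain ⟨e, he⟩ := Nat.exists_eq_add_of_lt hlt
    obtain ⟨f, rfl⟩ := Nat.exists_eq_add_of_le hc1
    have h3 := Nat.mul_le_mul_left (b k - b (k - 1)) hq
    have h4 : b k - b (k - 1) = e + 1 := by omega
    rw [h4] at hu h3
    generalize M / b k = q at *
    rw [Nat.add_sub_cancel_left] at hu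
    rw [he] at hqM ⊢
    nlinarith
  · rw [← hs]
    exact OB_le_of_last_pos hk1 hx h0

lemma sum_mul_add {k : ℕ} (b x : ℕ → ℕ) (a h d : ℕ) :
    ∑ i ∈ Icc 1 k, x i * (h * a + d * b i)
      = (∑ i ∈ Icc 1 k, x i) * (h * a) + d * ∑ i ∈ Icc 1 k, x i * b i := by
  rw [sum_mul, mul_sum, ← sum_add_distrib]
  exact sum_congr rfl fun i _ => by ring

lemma Ndr_le {k : ℕ} {b : ℕ → ℕ} (hk : 1 ≤ k) (hb1 : b 1 = 1) {a h d r M : ℕ}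
    (hM : M ≡ r [MOD a]) : Ndr k b a h d r ≤ OB k b M * (h * a) + d * M := by
  obtain ⟨x, hx, hs⟩ := exists_OB_eq hk hb1 M
  refine Nat.sInf_le ⟨⟨0, x, ?_⟩, ?_⟩
  · rw [sum_mul_add, hx, hs, zero_mul, zero_add]
  · rw [← mul_assoc, Nat.mul_add_mod_self_right]
    exact hM.mul_left d

lemma exists_le_Ndr {k : ℕ} {b : ℕ → ℕ} (hk : 1 ≤ k) (hb1 : b 1 = 1) {a d : ℕ}
    (hgcd : Nat.gcd a d = 1) (h r : ℕ) :
    ∃ M, M ≡ r [MOD a] ∧ OB k b M * (h * a) + d * M ≤ Ndr k b a h d r := by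
  have hne : {n : ℕ | (∃ x0 : ℕ, ∃ x : ℕ → ℕ,
      n = x0 * a + ∑ i ∈ Icc 1 k, x i * (h * a + d * b i)) ∧ n % a = d * r % a}.Nonempty := by
    obtain ⟨x, hx, hs⟩ := exists_OB_eq hk hb1 r
    refine ⟨_, ⟨0, x, rfl⟩, ?_⟩
    rw [sum_mul_add, hx, zero_mul, zero_add, ← mul_assoc, Nat.mul_add_mod_self_right]
  obtain ⟨⟨x0, x, hn⟩, hmod⟩ := Nat.sInf_mem hne
  change Ndr k b a h d r = _ at hn
  change Ndr k b a h d r % a = _ at hmod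
  rw [sum_mul_add] at hn
  refine ⟨∑ i ∈ Icc 1 k, x i * b i, Nat.ModEq.cancel_left_of_coprime hgcd ?_, ?_⟩
  · rw [hn, ← mul_assoc, Nat.mul_add_mod_self_right, Nat.mul_add_mod_self_right] at hmod
    exact hmod
  · rw [hn]
    have := Nat.mul_le_mul_right (h * a) (OB_le k b x)
    omega

theorem stmt_3 (k : ℕ) (b : ℕ → ℕ) (hk : 2 ≤ k) (hb1 : b 1 = 1)
    (hmono : ∀ i, 1 ≤ i → i < k → b i < b (i + 1))
    (c : ℕ) (hc : c = (Finset.range (b k)).sup fun r => OB k b r) (hc2 : 2 ≤ c)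
    (u : ℕ) (hu : u = max (c - 1) (((c - 1) * b (k - 1)) ⌈/⌉ (b k - b (k - 1))))
    (a h d : ℕ) (ha : 0 < a) (hh : 0 < h) (hd : 0 < d)
    (hgcd : Nat.gcd a d = 1) (ha' : (u + c - 1) * b k ≤ a) :
    (Finset.range a).sup (fun r => Ndr k b a h d r)
      = (Finset.Icc (a - b k) (a - 1)).sup (fun r => Ndr k b a h d r) := by
  have hk1 : 1 ≤ k := by omega
  have hbk : 0 < b k := by
    have := le_of_step_lt hmono le_rfl hk1 le_rfl
    omega
  have hlt : b (k - 1) < b k := by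
    simpa [Nat.sub_add_cancel hk1] using hmono (k - 1) (by omega) (by omega)
  have hu1 : 1 ≤ u := by
    have := le_max_left (c - 1) (((c - 1) * b (k - 1)) ⌈/⌉ (b k - b (k - 1)))
    omega
  have huc : (c - 1) * b (k - 1) ≤ (b k - b (k - 1)) * u := by
    rw [← smul_eq_mul (b k - b (k - 1)), ← ceilDiv_le_iff_le_smul (by omega), hu]
    exact le_max_right _ _
  have hba : b k ≤ a := ha'.trans' (Nat.le_mul_of_pos_left _ (by omega))
  have le_of_modEq : ∀ {M r : ℕ}, r < a → M ≡ r [MOD a] → r ≤ M := fun {M r} hr hM => by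
    rw [← Nat.mod_eq_of_lt hr, ← hM]
    exact Nat.mod_le _ _
  have hsmall : ∀ r, r < (u - 1) * b k → r < a - b k →
      Ndr k b a h d r ≤ Ndr k b a h d (a - b k) := by
    intro r hr hra
    obtain ⟨M, hM, hle⟩ := exists_le_Ndr (h := h) hk1 hb1 hgcd (a - b k)
    have hMa := le_of_modEq (by omega) hM
    refine (Ndr_le hk1 hb1 (Nat.ModEq.refl r)).trans (hle.trans' ?_)
    gcongr ?_ * _ + _ * ?_
    · have h1 := OB_le_div_add hk1 hb1 hbk r
      rw [← hc] at h1
      have h2 : r / b k < u - 1 := (Nat.div_lt_iff_lt_mul hbk).2 hr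
      have h3 := le_OB_mul_last hk1 hb1 hmono M
      have h4 : u + c - 1 ≤ OB k b M + 1 := by
        refine Nat.le_of_mul_le_mul_right (ha'.trans ?_) hbk
        rw [add_mul, one_mul]
        omega
      omega
    · omega
  have hlarge : ∀ r, (u - 1) * b k ≤ r → r < a - b k →
      Ndr k b a h d r ≤ Ndr k b a h d (r + b k) := by
    intro r hr hra
    obtain ⟨M, hM, hle⟩ := exists_le_Ndr (h := h) hk1 hb1 hgcd (r + b k)
    have hMa := le_of_modEq (by omega) hM
    obtain ⟨M, rfl⟩ := Nat.exists_eq_add_of_le' (show b k ≤ M by omega)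
    refine (Ndr_le hk1 hb1 (Nat.ModEq.add_right_cancel' _ hM)).trans (hle.trans' ?_)
    gcongr ?_ * _ + _ * ?_
    · exact OB_le_OB_add_last hk hb1 hmono hc (by omega) huc (by omega)
    · omega
  have hmain : ∀ n r, r < a → a - r ≤ n → Ndr k b a h d r
      ≤ (Finset.Icc (a - b k) (a - 1)).sup (fun r => Ndr k b a h d r) := by
    have htop : ∀ r, a - b k ≤ r → r < a → Ndr k b a h d r
        ≤ (Finset.Icc (a - b k) (a - 1)).sup (fun r => Ndr k b a h d r) := fun r h1 h2 =>
      le_sup (f := fun r => Ndr k b a h d r) (mem_Icc.2 ⟨h1, by omega⟩)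
    intro n
    induction n with
    | zero => intro r h1 h2; omega
    | succ n ih =>
      intro r hra hn
      rcases le_or_gt (a - b k) r with h1 | h1
      · exact htop r h1 hra
      rcases lt_or_ge r ((u - 1) * b k) with h2 | h2
      · exact (hsmall r h2 h1).trans (htop _ le_rfl (by omega))
      · exact (hlarge r h2 h1).trans (ih _ (by omega) (by omega))
  refine le_antisymm (Finset.sup_le fun r hr => hmain _ r (mem_range.1 hr) le_rfl) ?_
  refine sup_mono fun r hr => ?_
  rw [mem_Icc] at hr
  exact mem_range.2 (by omega)
end

section
/- Let B=(1,b_2,...,b_k) with 1<b_2<...<b_k positive integers (k≥2) be an orderly sequence, and let c = max{O_B(r) : 0 ≤ r ≤ b_k−1} with c ≥ 2. Let a,h,d be positive integers with gcd(a,d)=1. If a ≥ (c−1)b_k, then max{N_{dr} : 0 ≤ r ≤ a−1} = max{N_{dr} : a−b_k ≤ r ≤ a−1}. -/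
/-- `greedyCount b i M` is the number of parts used by the greedy algorithm
representing `M` using the coins `b 1 < b 2 < ⋯ < b i` (largest first). -/
def greedyCount (b : ℕ → ℕ) : ℕ → ℕ → ℕ
  | 0, _ => 0
  | i + 1, M => M / b (i + 1) + greedyCount b i (M % b (i + 1))


theorem OB_le_sum (k : ℕ) (b x : ℕ → ℕ) :
    OB k b (∑ i ∈ Finset.Icc 1 k, x i * b i) ≤ ∑ i ∈ Finset.Icc 1 k, x i :=
  Nat.sInf_le ⟨x, rfl, rfl⟩

theorem sum_single_one_mul {k : ℕ} (hk : 1 ≤ k) (f : ℕ → ℕ) (M : ℕ) :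
    ∑ i ∈ Finset.Icc 1 k, (if i = 1 then M else 0) * f i = M * f 1 := by
  simp [ite_mul, Finset.sum_ite_eq', hk]

theorem exists_sum_eq_OB {k : ℕ} {b : ℕ → ℕ} (hk : 1 ≤ k) (hb1 : b 1 = 1) (M : ℕ) :
    ∃ x : ℕ → ℕ, (∑ i ∈ Finset.Icc 1 k, x i * b i) = M ∧
      (∑ i ∈ Finset.Icc 1 k, x i) = OB k b M :=
  Nat.sInf_mem (s := {n : ℕ | ∃ x : ℕ → ℕ,
    (∑ i ∈ Finset.Icc 1 k, x i * b i) = M ∧ (∑ i ∈ Finset.Icc 1 k, x i) = n})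
    ⟨_, fun i => if i = 1 then M else 0, by rw [sum_single_one_mul hk, hb1, mul_one], rfl⟩

theorem greedyCount_add_largest {k : ℕ} {b : ℕ → ℕ} (hk : 1 ≤ k) (hb : 0 < b k) (M : ℕ) :
    greedyCount b k (M + b k) = greedyCount b k M + 1 := by
  obtain ⟨j, rfl⟩ : ∃ j, k = j + 1 := ⟨k - 1, by omega⟩
  simp only [greedyCount, Nat.add_div_right _ hb, Nat.add_mod_right]
  omega

theorem sum_generators (k : ℕ) (b x : ℕ → ℕ) (a h d : ℕ) :
    ∑ i ∈ Finset.Icc 1 k, x i * (h * a + d * b i)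
      = (∑ i ∈ Finset.Icc 1 k, x i) * (h * a) + d * ∑ i ∈ Finset.Icc 1 k, x i * b i := by
  rw [Finset.sum_mul, Finset.mul_sum, ← Finset.sum_add_distrib]
  exact Finset.sum_congr rfl fun i _ => by ring

theorem generator_sum_mod (x0 n h a m : ℕ) :
    (x0 * a + (n * (h * a) + m)) % a = m % a := by
  rw [show x0 * a + (n * (h * a) + m) = m + a * (x0 + n * h) by ring, Nat.add_mul_mod_self_left]

theorem exists_eq_Ndr {k : ℕ} {b : ℕ → ℕ} (hk : 1 ≤ k) (hb1 : b 1 = 1) (a h d r : ℕ) :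
    (∃ x0 : ℕ, ∃ x : ℕ → ℕ,
      Ndr k b a h d r = x0 * a + ∑ i ∈ Finset.Icc 1 k, x i * (h * a + d * b i)) ∧
      Ndr k b a h d r % a = d * r % a := by
  refine Nat.sInf_mem (s := {n : ℕ | (∃ x0 : ℕ, ∃ x : ℕ → ℕ,
      n = x0 * a + ∑ i ∈ Finset.Icc 1 k, x i * (h * a + d * b i)) ∧ n % a = d * r % a})
    ⟨_, ⟨0, fun i => if i = 1 then r else 0, rfl⟩, ?_⟩
  rw [sum_generators, generator_sum_mod, sum_single_one_mul hk, hb1, mul_one]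

/-- If adding the largest part always raises the optimum by one, then `Ndr` does not decrease
when `r` is raised by the largest part, as long as no wrap-around modulo `a` occurs. -/
theorem Ndr_le_Ndr_add_largest {k : ℕ} {b : ℕ → ℕ} (hk : 1 ≤ k) (hb1 : b 1 = 1)
    (hstep : ∀ M, OB k b (M + b k) = OB k b M + 1) {a h d r : ℕ}
    (hgcd : Nat.gcd a d = 1) (hr : r + b k < a) :
    Ndr k b a h d r ≤ Ndr k b a h d (r + b k) := by
  obtain ⟨⟨x0, x, hx⟩, hmod⟩ := exists_eq_Ndr hk hb1 a h d (r + b k)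
  rw [hx, sum_generators, generator_sum_mod] at hmod
  have hopt := OB_le_sum k b x
  rw [hx, sum_generators]
  generalize (∑ i ∈ Finset.Icc 1 k, x i * b i) = M' at *
  generalize (∑ i ∈ Finset.Icc 1 k, x i) = n at *
  have hM' : M' ≡ r + b k [MOD a] := Nat.ModEq.cancel_left_of_coprime hgcd hmod
  have hle : r + b k ≤ M' := by
    rw [← Nat.mod_eq_of_lt hr, ← hM']
    exact Nat.mod_le _ _
  obtain ⟨M, rfl⟩ : ∃ M, M' = M + b k := ⟨M' - b k, by omega⟩
  have hM : M ≡ r [MOD a] := Nat.ModEq.add_right_cancel' _ hM'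
  obtain ⟨y, hyM, hyO⟩ := exists_sum_eq_OB hk hb1 M
  rw [hstep] at hopt
  calc Ndr k b a h d r
      ≤ x0 * a + ∑ i ∈ Finset.Icc 1 k, y i * (h * a + d * b i) := by
        refine Nat.sInf_le ⟨⟨x0, y, rfl⟩, ?_⟩
        rw [sum_generators, generator_sum_mod, hyM]
        exact hM.mul_left d
    _ = x0 * a + (OB k b M * (h * a) + d * M) := by rw [sum_generators, hyM, hyO]
    _ ≤ x0 * a + (n * (h * a) + d * (M + b k)) := by gcongr <;> omega

theorem stmt_8 (k : ℕ) (b : ℕ → ℕ) (hk : 2 ≤ k) (hb1 : b 1 = 1)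
    (hmono : ∀ i, 1 ≤ i → i < k → b i < b (i + 1))
    (horderly : ∀ M : ℕ, OB k b M = greedyCount b k M)
    (c : ℕ) (hc : c = (Finset.range (b k)).sup fun r => OB k b r) (hc2 : 2 ≤ c)
    (a h d : ℕ) (ha : 0 < a) (hh : 0 < h) (hd : 0 < d)
    (hgcd : Nat.gcd a d = 1) (ha' : (c - 1) * b k ≤ a) :
    (Finset.range a).sup (fun r => Ndr k b a h d r)
      = (Finset.Icc (a - b k) (a - 1)).sup (fun r => Ndr k b a h d r) := by
  have hk1 : 1 ≤ k := by omega
  have hpos : 0 < b k := by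
    have := hmono (k - 1) (by omega) (by omega)
    rw [Nat.sub_add_cancel hk1] at this
    omega
  have hstep : ∀ M, OB k b (M + b k) = OB k b M + 1 := fun M => by
    rw [horderly, horderly, greedyCount_add_largest hk1 hpos]
  apply le_antisymm
  · have key : ∀ n r, a - r = n → r < a → Ndr k b a h d r
        ≤ (Finset.Icc (a - b k) (a - 1)).sup (fun r => Ndr k b a h d r) := by
      intro n
      induction n using Nat.strong_induction_on with
      | _ n ih =>
        intro r hn hr
        by_cases hlt : r + b k < a
        · exact (Ndr_le_Ndr_add_largest hk1 hb1 hstep hgcd hlt).trans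
            (ih _ (by omega) (r + b k) rfl hlt)
        · exact Finset.le_sup (f := fun r => Ndr k b a h d r)
            (Finset.mem_Icc.2 ⟨by omega, by omega⟩)
    exact Finset.sup_le fun r hr => key _ r rfl (Finset.mem_range.1 hr)
  · refine Finset.sup_mono fun r hr => ?_
    rw [Finset.mem_Icc] at hr
    exact Finset.mem_range.2 (by omega)
end
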